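/- Let n ≥ 1 and let (a_1,…,a_{n−1}) be nonnegative integers. Then N(a_1,…,a_{n−1}) > 0 if and only if the point (a_1,…,a_{n−1}) ∈ ℝ^{n−1} belongs to the associahedron Ass_{n−1} := Σ_{1 ≤ i < j ≤ n} Δ_{[i, j−1]}, the Minkowski sum of the coordinate simplices Δ_{[i,j−1]} := ConvexHull{e_i, e_{i+1}, …, e_{j−1}} ⊆ ℝ^{n−1} over all pairs 1 ≤ i < j ≤ n. Consequently, the number of distinct diagonal vectors of standard shifted Young tableaux of shape (n, n−1, …, 1) equals the number of integer lattice points of Ass_{n−1}. -/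

import Mathlib

open Pointwise

/-- The cells `(i,j)` with `1 ≤ i ≤ j ≤ n` of the shifted triangular shape
`(n, n−1, …, 1)` (here `0`-indexed). -/
def ShiftedCell (n : ℕ) : Type := {p : Fin n × Fin n // p.1 ≤ p.2}

/-- A standard shifted Young tableau of triangular shape `(n, n−1, …, 1)`. -/
def IsShiftedSYT (n : ℕ) (T : ShiftedCell n → ℕ) : Prop :=
  Function.Injective T ∧
  Set.range T = Set.Icc 1 (n * (n + 1) / 2) ∧
  (∀ p q : ShiftedCell n, ((p.1.1 : ℕ) + 1 = (q.1.1 : ℕ) ∧ p.1.2 = q.1.2) → T p < T q) ∧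
  (∀ p q : ShiftedCell n, (p.1.1 = q.1.1 ∧ (p.1.2 : ℕ) + 1 = (q.1.2 : ℕ)) → T p < T q)

/-- The `i`-th diagonal entry `T(i,i)` of a shifted tableau. -/
def diagEntry (n : ℕ) (T : ShiftedCell n → ℕ) (i : Fin n) : ℕ := T ⟨(i, i), le_refl i⟩

/-- `N(a_1,…,a_n)`: the number of standard shifted Young tableaux of triangular shape
`(n+1, n, …, 1)` with diagonal vector determined by `a`. -/
noncomputable def Ntab (n : ℕ) (a : Fin n → ℕ) : ℕ :=
  Set.ncard {T : ShiftedCell (n + 1) → ℕ | IsShiftedSYT (n + 1) T ∧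
    diagEntry (n + 1) T 0 = 1 ∧
    ∀ i : Fin n, diagEntry (n + 1) T i.succ = diagEntry (n + 1) T i.castSucc + a i + 1}

/-- The `i`-th standard basis vector of `ℝ^n`. -/
def stdVec (n : ℕ) (i : Fin n) : Fin n → ℝ := fun j => if j = i then 1 else 0

/-- The coordinate simplex `Δ_I = ConvexHull{e_i : i ∈ I}`. -/
def coordSimplex (n : ℕ) (I : Finset (Fin n)) : Set (Fin n → ℝ) :=
  convexHull ℝ {p | ∃ i ∈ I, p = stdVec n i}

/-- The associahedron `Ass_n = Σ_{1 ≤ i < j ≤ n+1} Δ_{[i, j−1]} ⊆ ℝ^n` (Loday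
realization, as a Minkowski sum of coordinate simplices). -/
def assocPolytope (n : ℕ) : Set (Fin n → ℝ) :=
  ∑ p ∈ Finset.univ.filter (fun p : Fin (n + 1) × Fin (n + 1) => p.1 < p.2),
    coordSimplex n (Finset.univ.filter fun k : Fin n =>
      (p.1 : ℕ) ≤ (k : ℕ) ∧ (k : ℕ) < (p.2 : ℕ))

instance (n : ℕ) : Fintype (ShiftedCell n) :=
  inferInstanceAs (Fintype {p : Fin n × Fin n // p.1 ≤ p.2})

instance (n : ℕ) : DecidableEq (ShiftedCell n) :=
  inferInstanceAs (DecidableEq {p : Fin n × Fin n // p.1 ≤ p.2})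

/-- The off-diagonal cells of the shape `(n+1, n, …, 1)`, which index the Minkowski summands
of the associahedron. -/
abbrev OffDiag (n : ℕ) : Type := {p : Fin (n + 1) × Fin (n + 1) // p.1 < p.2}

/-- The map `f` sends each pair `i < j` to some `k` with `i ≤ k < j`, and `k` is hit
`a k` times. -/
def IsChoice (n : ℕ) (a : Fin n → ℕ) (f : OffDiag n → Fin n) : Prop :=
  (∀ p, (p.1.1 : ℕ) ≤ f p ∧ (f p : ℕ) < p.1.2) ∧
    ∀ k, (Finset.univ.filter fun p => f p = k).card = a k

theorem card_shiftedCell (n : ℕ) : Fintype.card (ShiftedCell n) = n * (n + 1) / 2 := by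
  have h : Fintype.card (ShiftedCell n) = ∑ j : Fin n, ((j : ℕ) + 1) := by
    change Fintype.card {p : Fin n × Fin n // p.1 ≤ p.2} = _
    rw [Fintype.card_subtype, Finset.card_filter, Fintype.sum_prod_type_right]
    refine Finset.sum_congr rfl fun j _ => ?_
    rw [← Finset.card_filter, ← Fin.card_Iic]
    congr 1
    ext i
    simp
  rw [h, Fin.sum_univ_eq_sum_range (fun j => j + 1), Finset.sum_add_distrib]
  have := Finset.sum_range_id_mul_two n
  simp only [Finset.sum_const, Finset.card_range, smul_eq_mul, mul_one]
  rcases n with _ | n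
  · simp
  · simp only [Nat.add_sub_cancel] at this
    have e : (n + 1) * (n + 1 + 1) = (n + 1) * n + (n + 1) * 2 := by ring
    omega

theorem coordSimplex_subset (n : ℕ) (I : Finset (Fin n)) :
    coordSimplex n I ⊆ {y | (∀ k, 0 ≤ y k) ∧ (∀ k, k ∉ I → y k = 0) ∧ ∑ k, y k = 1} := by
  refine convexHull_min ?_ ?_
  · rintro _ ⟨i, hi, rfl⟩
    refine ⟨fun k => ?_, fun k hk => ?_, ?_⟩
    · unfold stdVec; split_ifs <;> norm_num
    · unfold stdVec; rw [if_neg]; rintro rfl; exact hk hi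
    · simp [stdVec]
  · rintro x ⟨hx1, hx2, hx3⟩ y ⟨hy1, hy2, hy3⟩ s t hs ht hst
    refine ⟨fun k => ?_, fun k hk => ?_, ?_⟩
    · have := hx1 k
      have := hy1 k
      simp only [Pi.add_apply, Pi.smul_apply, smul_eq_mul]
      positivity
    · simp [hx2 k hk, hy2 k hk]
    · simp [Finset.sum_add_distrib, ← Finset.mul_sum, hx3, hy3, hst]

theorem exists_decomposition (n : ℕ) {x : Fin n → ℝ} (hx : x ∈ assocPolytope n) :
    ∃ y : OffDiag n → Fin n → ℝ, (∀ p k, 0 ≤ y p k) ∧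
      (∀ p (k : Fin n), ¬ ((p.1.1 : ℕ) ≤ k ∧ (k : ℕ) < p.1.2) → y p k = 0) ∧
      (∀ p, ∑ k, y p k = 1) ∧ ∀ k, x k = ∑ p, y p k := by
  unfold assocPolytope at hx
  rw [Set.mem_finsetSum] at hx
  obtain ⟨g, hg, rfl⟩ := hx
  have hg' : ∀ p : OffDiag n, _ := fun p =>
    coordSimplex_subset n _ (hg (i := p.1) (by simpa using p.2))
  refine ⟨fun p => g p.1, fun p => (hg' p).1, fun p k hk => (hg' p).2.1 k (by simpa using hk),
    fun p => (hg' p).2.2, fun k => ?_⟩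
  rw [Finset.sum_apply]
  exact Finset.sum_subtype _ (by simp) _

/-- Integrality of the Minkowski sum, by Hall's marriage theorem. -/
theorem exists_isChoice_of_mem (n : ℕ) (a : Fin n → ℕ)
    (ha : (fun i => (a i : ℝ)) ∈ assocPolytope n) : ∃ f, IsChoice n a f := by
  obtain ⟨y, hy0, hys, hy1, hya⟩ := exists_decomposition n ha
  let t : OffDiag n → Finset (Σ k : Fin n, Fin (a k)) := fun p =>
    Finset.univ.filter fun s => (p.1.1 : ℕ) ≤ s.1 ∧ (s.1 : ℕ) < p.1.2
  have hall : ∀ S : Finset (OffDiag n), S.card ≤ (S.biUnion t).card := by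
    intro S
    let K : Finset (Fin n) := Finset.univ.filter fun k =>
      ∃ p ∈ S, (p.1.1 : ℕ) ≤ k ∧ (k : ℕ) < p.1.2
    have hK : S.biUnion t = K.sigma fun k => (Finset.univ : Finset (Fin (a k))) := by
      ext s
      simp [t, K]
    rw [hK, Finset.card_sigma]
    simp only [Finset.card_univ, Fintype.card_fin]
    have h1 : ∀ p ∈ S, ∑ k ∈ K, y p k = 1 := by
      intro p hp
      rw [← hy1 p]
      refine Finset.sum_subset (Finset.subset_univ _) fun k _ hk => hys p k fun h => hk ?_
      simp only [K, Finset.mem_filter, Finset.mem_univ, true_and]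
      exact ⟨p, hp, h⟩
    have h2 : (S.card : ℝ) ≤ ∑ k ∈ K, (a k : ℝ) := by
      calc (S.card : ℝ) = ∑ p ∈ S, ∑ k ∈ K, y p k := by
            rw [Finset.sum_congr rfl h1]; simp
        _ = ∑ k ∈ K, ∑ p ∈ S, y p k := Finset.sum_comm
        _ ≤ ∑ k ∈ K, (a k : ℝ) := by
            refine Finset.sum_le_sum fun k _ => ?_
            rw [hya k]
            exact Finset.sum_le_sum_of_subset_of_nonneg (Finset.subset_univ _)
              fun p _ _ => hy0 p k
    exact_mod_cast h2
  obtain ⟨g, hginj, hg⟩ := (Finset.all_card_le_biUnion_card_iff_exists_injective t).1 hall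
  have hcard : Fintype.card (OffDiag n) = Fintype.card (Σ k : Fin n, Fin (a k)) := by
    rw [Fintype.card_sigma]
    simp only [Fintype.card_fin]
    have : (Fintype.card (OffDiag n) : ℝ) = ∑ k, (a k : ℝ) := by
      rw [Finset.sum_congr rfl fun k _ => hya k, Finset.sum_comm]
      simp [hy1]
    exact_mod_cast this
  have hbij : Function.Bijective g := (Fintype.bijective_iff_injective_and_card g).2 ⟨hginj, hcard⟩
  refine ⟨fun p => (g p).1, fun p => by simpa [t] using hg p, fun k => ?_⟩
  have : (Finset.univ.filter fun p => (g p).1 = k).card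
      = (Finset.univ.filter fun s : (Σ k : Fin n, Fin (a k)) => s.1 = k).card :=
    Finset.card_bijective g hbij (by simp)
  rw [this]
  have h3 : (Finset.univ.filter fun s : (Σ k : Fin n, Fin (a k)) => s.1 = k)
      = ({k} : Finset (Fin n)).sigma fun k => (Finset.univ : Finset (Fin (a k))) := by
    ext s
    simp
  rw [h3, Finset.card_sigma]
  simp

theorem mem_assocPolytope_of_isChoice (n : ℕ) (a : Fin n → ℕ) (f : OffDiag n → Fin n)
    (hf : IsChoice n a f) : (fun i => (a i : ℝ)) ∈ assocPolytope n := by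
  unfold assocPolytope
  rw [Set.mem_finsetSum]
  refine ⟨fun p => if h : p.1 < p.2 then stdVec n (f ⟨p, h⟩) else 0, ?_, ?_⟩
  · intro p hp
    have h : p.1 < p.2 := by simpa using hp
    simp only [h, dif_pos]
    refine subset_convexHull ℝ _ ⟨_, ?_, rfl⟩
    simpa using hf.1 ⟨p, h⟩
  · rw [Finset.sum_subtype (p := fun p : Fin (n + 1) × Fin (n + 1) => p.1 < p.2) _ (by simp)]
    ext k
    rw [Finset.sum_apply, ← hf.2 k, Finset.card_filter]
    push_cast
    refine Finset.sum_congr rfl fun p _ => ?_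
    rw [dif_pos p.2]
    simp [stdVec, eq_comm]

/-- Exchanging the values of a choice function at an inversion keeps it a choice function, so a
suitable extremal one has no inversions. -/
theorem exists_monotone_isChoice (n : ℕ) (a : Fin n → ℕ) (h : ∃ f, IsChoice n a f) :
    ∃ f, IsChoice n a f ∧
      ∀ p q : OffDiag n, p.1.1 ≤ q.1.1 → p.1.2 ≤ q.1.2 → f p ≤ f q := by
  classical
  let w : (OffDiag n → Fin n) → ℤ := fun f =>
    ∑ p : OffDiag n, (((p.1.1 : ℕ) : ℤ) + ((p.1.2 : ℕ) : ℤ)) * ((f p : ℕ) : ℤ)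
  obtain ⟨f, hf, hmax⟩ := Set.exists_max_image {f | IsChoice n a f} w (Set.toFinite _) h
  refine ⟨f, hf, fun p q h1 h2 => ?_⟩
  by_contra! hlt
  have hpq : p ≠ q := by rintro rfl; exact lt_irrefl _ hlt
  have hg : IsChoice n a (f ∘ Equiv.swap p q) := by
    constructor
    · intro r
      have hp := hf.1 p
      have hq := hf.1 q
      have hlt' : (f q : ℕ) < f p := hlt
      have h1' : (p.1.1 : ℕ) ≤ q.1.1 := h1
      have h2' : (p.1.2 : ℕ) ≤ q.1.2 := h2
      simp only [Function.comp]
      by_cases hrp : r = p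
      · subst hrp; rw [Equiv.swap_apply_left]; omega
      by_cases hrq : r = q
      · subst hrq; rw [Equiv.swap_apply_right]; omega
      rw [Equiv.swap_apply_of_ne_of_ne hrp hrq]
      exact hf.1 r
    · intro k
      rw [← hf.2 k]
      exact Finset.card_bijective (Equiv.swap p q) (Equiv.bijective _) (by simp)
  have hle := hmax _ hg
  have hsub : w (f ∘ Equiv.swap p q) - w f
      = ((((q.1.1 : ℕ) : ℤ) + ((q.1.2 : ℕ) : ℤ)) - (((p.1.1 : ℕ) : ℤ) + ((p.1.2 : ℕ) : ℤ)))
        * (((f p : ℕ) : ℤ) - ((f q : ℕ) : ℤ)) := by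
    simp only [w]
    rw [← Finset.sum_sub_distrib, ← Finset.sum_subset (Finset.subset_univ {p, q})]
    · rw [Finset.sum_pair hpq]
      simp only [Function.comp, Equiv.swap_apply_left, Equiv.swap_apply_right]
      ring
    · intro r _ hr
      simp only [Finset.mem_insert, Finset.mem_singleton, not_or] at hr
      simp [Equiv.swap_apply_of_ne_of_ne hr.1 hr.2]
  have hlt1 : (0 : ℤ) < ((f p : ℕ) : ℤ) - ((f q : ℕ) : ℤ) := by
    have : (f q : ℕ) < f p := hlt
    omega
  have hlt2 : (0 : ℤ) < (((q.1.1 : ℕ) : ℤ) + ((q.1.2 : ℕ) : ℤ))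
      - (((p.1.1 : ℕ) : ℤ) + ((p.1.2 : ℕ) : ℤ)) := by
    have h1' : (p.1.1 : ℕ) ≤ q.1.1 := h1
    have h2' : (p.1.2 : ℕ) ≤ q.1.2 := h2
    have : ¬ ((p.1.1 : ℕ) = q.1.1 ∧ (p.1.2 : ℕ) = q.1.2) := fun h =>
      hpq (Subtype.ext (Prod.ext (Fin.ext h.1) (Fin.ext h.2)))
    omega
  have := mul_pos hlt2 hlt1
  omega

/-- The tableau ranking the cells by an injective key which increases along rows and columns. -/
theorem isShiftedSYT_rank (n : ℕ) (E : ShiftedCell n → ℕ) (hE : Function.Injective E)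
    (hcol : ∀ p q : ShiftedCell n, ((p.1.1 : ℕ) + 1 = (q.1.1 : ℕ) ∧ p.1.2 = q.1.2) → E p < E q)
    (hrow : ∀ p q : ShiftedCell n, (p.1.1 = q.1.1 ∧ (p.1.2 : ℕ) + 1 = (q.1.2 : ℕ)) → E p < E q) :
    IsShiftedSYT n fun p => (Finset.univ.filter fun q => E q ≤ E p).card := by
  have hlt : ∀ p q, E p < E q → (Finset.univ.filter fun r => E r ≤ E p).card
      < (Finset.univ.filter fun r => E r ≤ E q).card := by
    intro p q h
    refine Finset.card_lt_card (Finset.ssubset_iff_of_subset ?_ |>.2 ⟨q, by simp, by simpa⟩)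
    intro r hr
    simp only [Finset.mem_filter, Finset.mem_univ, true_and] at hr ⊢
    omega
  have hinj : Function.Injective fun p => (Finset.univ.filter fun q => E q ≤ E p).card := by
    intro p q h
    by_contra hne
    rcases lt_or_gt_of_ne (fun e => hne (hE e)) with h' | h'
    · exact (hlt _ _ h').ne h
    · exact (hlt _ _ h').ne' h
  refine ⟨hinj, ?_, fun p q h => hlt _ _ (hcol p q h), fun p q h => hlt _ _ (hrow p q h)⟩
  rw [← card_shiftedCell]
  have himg : Finset.univ.image (fun p => (Finset.univ.filter fun q => E q ≤ E p).card)
      = Finset.Icc 1 (Fintype.card (ShiftedCell n)) := by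
    refine Finset.eq_of_subset_of_card_le ?_ ?_
    · intro m hm
      obtain ⟨p, -, rfl⟩ := Finset.mem_image.1 hm
      exact Finset.mem_Icc.2 ⟨Finset.card_pos.2 ⟨p, by simp⟩, Finset.card_le_univ _⟩
    · rw [Finset.card_image_of_injective _ hinj]
      simp
  have := congrArg (fun s : Finset ℕ => (s : Set ℕ)) himg
  simpa using this

/-- The stage at which a cell is filled: the diagonal cell `(i, i)` at stage `2 i`, an
off-diagonal cell `p` at stage `2 f(p) + 1`. -/
def stage (n : ℕ) (f : OffDiag n → Fin n) (p : ShiftedCell (n + 1)) : ℕ :=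
  if h : p.1.1 < p.1.2 then 2 * (f ⟨p.1, h⟩ : ℕ) + 1 else 2 * p.1.1

theorem card_stage_odd (n : ℕ) (a : Fin n → ℕ) (f : OffDiag n → Fin n) (hf : IsChoice n a f)
    (k : Fin n) : (Finset.univ.filter fun p => stage n f p = 2 * k + 1).card = a k := by
  rw [← hf.2 k]
  symm
  refine Finset.card_bij (fun p _ => (⟨p.1, p.2.le⟩ : ShiftedCell (n + 1))) ?_ ?_ ?_
  · intro p hp
    refine (Finset.mem_filter_univ _).2 ?_
    rw [← (Finset.mem_filter_univ _).1 hp]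
    exact dif_pos p.2
  · intro p _ q _ h
    exact Subtype.ext (congrArg (fun c : ShiftedCell (n + 1) => c.1) h)
  · intro p hp
    simp only [Finset.mem_filter, Finset.mem_univ, true_and] at hp
    unfold stage at hp
    split_ifs at hp with h
    · refine ⟨⟨p.1, h⟩, ?_, rfl⟩
      simp only [Finset.mem_filter, Finset.mem_univ, true_and]
      exact Fin.ext (by omega)
    · omega

theorem stage_eq_even_iff (n : ℕ) (f : OffDiag n → Fin n) (i : Fin (n + 1))
    (p : ShiftedCell (n + 1)) : stage n f p = 2 * i ↔ p = ⟨(i, i), le_refl i⟩ := by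
  constructor
  · intro h
    unfold stage at h
    split_ifs at h with h'
    · omega
    · have h1 : p.1.1 = i := Fin.ext (by omega)
      have h2 : p.1.2 = i := by rw [← h1]; exact le_antisymm (not_lt.1 h') p.2
      exact Subtype.ext (Prod.ext h1 h2)
  · rintro rfl
    simp [stage]

theorem exists_tableau_of_isChoice (n : ℕ) (a : Fin n → ℕ) (h : ∃ f, IsChoice n a f) :
    ∃ T : ShiftedCell (n + 1) → ℕ, IsShiftedSYT (n + 1) T ∧ diagEntry (n + 1) T 0 = 1 ∧
      ∀ i : Fin n, diagEntry (n + 1) T i.succ = diagEntry (n + 1) T i.castSucc + a i + 1 := by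
  obtain ⟨f, hf, hmono⟩ := exists_monotone_isChoice n a h
  let pos : ShiftedCell (n + 1) → ℕ := fun p => p.1.1 * (n + 1) + p.1.2
  let M : ℕ := (n + 1) * (n + 1)
  let E : ShiftedCell (n + 1) → ℕ := fun p => stage n f p * M + pos p
  have hpos : ∀ p, pos p < M := fun p => by
    have h1 := p.1.1.2
    have h2 := p.1.2.2
    simp only [pos, M]
    nlinarith
  have hElt : ∀ p q, stage n f p < stage n f q → E p < E q := fun p q h => by
    have := hpos p
    simp only [E]
    nlinarith
  have hElt' : ∀ p q, stage n f p ≤ stage n f q → pos p < pos q → E p < E q := fun p q h h' => by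
    have := Nat.mul_le_mul_right M h
    simp only [E]
    omega
  have hEinj : Function.Injective E := by
    intro p q hpq
    have hs : stage n f p = stage n f q := by
      by_contra hne
      rcases lt_or_gt_of_ne hne with h' | h'
      · exact (hElt _ _ h').ne hpq
      · exact (hElt _ _ h').ne' hpq
    have hp : pos p = pos q := by
      simp only [E, hs] at hpq
      omega
    have h1 := p.1.2.2
    have h2 := q.1.2.2
    have e1 : p.1.1 = q.1.1 := by
      apply Fin.ext
      have := congrArg (· / (n + 1)) hp
      simp only [pos] at this
      rw [mul_comm, Nat.mul_add_div (by omega), mul_comm, Nat.mul_add_div (by omega),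
        Nat.div_eq_of_lt h1, Nat.div_eq_of_lt h2] at this
      simpa using this
    have e2 : p.1.2 = q.1.2 := by
      apply Fin.ext
      simp only [pos, e1] at hp
      omega
    exact Subtype.ext (Prod.ext e1 e2)
  have hdiag : ∀ i : Fin (n + 1), stage n f ⟨(i, i), le_refl i⟩ = 2 * i := fun i =>
    (stage_eq_even_iff n f i _).2 rfl
  have hT := isShiftedSYT_rank (n + 1) E hEinj ?_ ?_
  · have hd : ∀ i : Fin (n + 1), diagEntry (n + 1)
        (fun p => (Finset.univ.filter fun q => E q ≤ E p).card) i
        = (Finset.univ.filter fun q => stage n f q ≤ 2 * i).card := by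
      intro i
      unfold diagEntry
      refine congrArg Finset.card (Finset.ext fun q => ?_)
      simp only [Finset.mem_filter, Finset.mem_univ, true_and]
      constructor
      · intro hq
        by_contra! hlt
        rw [← hdiag i] at hlt
        exact absurd (hElt _ _ hlt) (not_lt.2 hq)
      · intro hq
        rcases hq.lt_or_eq with h' | h'
        · rw [← hdiag i] at h'
          exact (hElt _ _ h').le
        · rw [(stage_eq_even_iff n f i q).1 h']
    have hone : ∀ i : Fin (n + 1),
        (Finset.univ.filter fun q => stage n f q = 2 * i).card = 1 := by
      intro i
      rw [Finset.card_eq_one]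
      refine ⟨⟨(i, i), le_refl i⟩, Finset.ext fun q => ?_⟩
      rw [Finset.mem_filter_univ, stage_eq_even_iff]
      exact Finset.mem_singleton.symm
    refine ⟨_, hT, ?_, fun i => ?_⟩
    · rw [hd]
      simpa using hone 0
    · rw [hd, hd, ← card_stage_odd n a f hf i, ← Finset.card_union_of_disjoint]
      refine Eq.trans ?_ (congrArg _ (hone i.succ))
      rw [← Finset.card_union_of_disjoint]
      · refine congrArg Finset.card (Finset.ext fun q => ?_)
        simp only [Finset.mem_filter, Finset.mem_univ, true_and, Finset.mem_union, Fin.val_succ,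
          Fin.val_castSucc]
        omega
      · rw [Finset.disjoint_left]
        intro q
        simp only [Finset.mem_filter, Finset.mem_univ, true_and, Finset.mem_union, Fin.val_succ,
          Fin.val_castSucc]
        omega
      · rw [Finset.disjoint_left]
        intro q
        simp only [Finset.mem_filter, Finset.mem_univ, true_and, Fin.val_castSucc]
        omega
  · rintro p q ⟨h1, h2⟩
    have h2' : (p.1.2 : ℕ) = q.1.2 := congrArg _ h2
    have hq : (q.1.1 : ℕ) ≤ q.1.2 := q.2
    refine hElt' _ _ ?_ ?_
    · have hp : p.1.1 < p.1.2 := by rw [Fin.lt_def]; omega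
      have hfp := hf.1 ⟨p.1, hp⟩
      unfold stage
      rw [dif_pos hp]
      split_ifs with h'
      · have : (f ⟨p.1, hp⟩ : ℕ) ≤ f ⟨q.1, h'⟩ :=
          hmono ⟨p.1, hp⟩ ⟨q.1, h'⟩ (by rw [Fin.le_def]; simp only; omega) h2.le
        omega
      · rw [Fin.lt_def] at h'
        simp only at hfp
        omega
    · simp only [pos, ← h1, h2']
      nlinarith
  · rintro p q ⟨h1, h2⟩
    have h1' : (p.1.1 : ℕ) = q.1.1 := congrArg _ h1
    have hp : (p.1.1 : ℕ) ≤ p.1.2 := p.2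
    refine hElt' _ _ ?_ ?_
    · have hq : q.1.1 < q.1.2 := by rw [Fin.lt_def]; omega
      have hfq := hf.1 ⟨q.1, hq⟩
      unfold stage
      rw [dif_pos hq]
      split_ifs with h'
      · have : (f ⟨p.1, h'⟩ : ℕ) ≤ f ⟨q.1, hq⟩ :=
          hmono ⟨p.1, h'⟩ ⟨q.1, hq⟩ h1.le (by rw [Fin.le_def]; simp only; omega)
        omega
      · simp only at hfq
        omega
    · simp only [pos, h1', ← h2]
      omega

theorem IsShiftedSYT.monotone {n : ℕ} {T : ShiftedCell n → ℕ} (hT : IsShiftedSYT n T)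
    (p q : ShiftedCell n) (h1 : p.1.1 ≤ q.1.1) (h2 : p.1.2 ≤ q.1.2) : T p ≤ T q := by
  obtain ⟨-, -, hcol, hrow⟩ := hT
  have hr : ∀ d : ℕ, ∀ p q : ShiftedCell n, p.1.1 = q.1.1 → (p.1.2 : ℕ) + d = q.1.2 →
      T p ≤ T q := by
    intro d
    induction d with
    | zero =>
      intro p q h1 h2
      rw [show p = q from Subtype.ext (Prod.ext h1 (Fin.ext h2))]
    | succ d ih =>
      intro p q h1 h2
      have hq := q.1.2.2
      have hp : (p.1.1 : ℕ) ≤ p.1.2 := p.2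
      let r : ShiftedCell n := ⟨(p.1.1, ⟨p.1.2 + 1, by omega⟩), by
        rw [Fin.le_def]; simp only; omega⟩
      exact (hrow p r ⟨rfl, rfl⟩).le.trans (ih r q h1 (by simp only [r]; omega))
  have hc : ∀ d : ℕ, ∀ p q : ShiftedCell n, (p.1.1 : ℕ) + d = q.1.1 → p.1.2 = q.1.2 →
      T p ≤ T q := by
    intro d
    induction d with
    | zero =>
      intro p q h1 h2
      rw [show p = q from Subtype.ext (Prod.ext (Fin.ext h1) h2)]
    | succ d ih =>
      intro p q h1 h2
      have hq := q.1.1.2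
      have hq' : (q.1.1 : ℕ) ≤ q.1.2 := q.2
      have h2' : (p.1.2 : ℕ) = q.1.2 := congrArg _ h2
      let r : ShiftedCell n := ⟨(⟨p.1.1 + 1, by omega⟩, p.1.2), by
        rw [Fin.le_def]; simp only; omega⟩
      exact (hcol p r ⟨rfl, rfl⟩).le.trans (ih r q (by simp only [r]; omega) h2)
  have h1' : (p.1.1 : ℕ) ≤ q.1.1 := h1
  have h2' : (p.1.2 : ℕ) ≤ q.1.2 := h2
  let r : ShiftedCell n := ⟨(p.1.1, q.1.2), p.2.trans h2⟩
  exact (hr (q.1.2 - p.1.2) p r rfl (by simp only [r]; omega)).trans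
    (hc (q.1.1 - p.1.1) r q (by simp only [r]; omega) rfl)

theorem IsShiftedSYT.diagEntry_strictMono {n : ℕ} {T : ShiftedCell n → ℕ}
    (hT : IsShiftedSYT n T) : StrictMono (diagEntry n T) := by
  intro i j hij
  refine lt_of_le_of_ne (hT.monotone _ _ hij.le hij.le) fun h => hij.ne ?_
  exact congrArg (fun c : ShiftedCell n => c.1.1) (hT.1 h)

theorem IsShiftedSYT.diagEntry_zero {n : ℕ} {T : ShiftedCell (n + 1) → ℕ}
    (hT : IsShiftedSYT (n + 1) T) : diagEntry (n + 1) T 0 = 1 := by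
  have h1 : 1 ∈ Set.range T := by
    rw [hT.2.1, Set.mem_Icc]
    refine ⟨le_rfl, ?_⟩
    rw [Nat.le_div_iff_mul_le (by norm_num)]
    nlinarith
  obtain ⟨p, hp⟩ := h1
  have hle : diagEntry (n + 1) T 0 ≤ 1 := by
    exact (hT.monotone _ p (Fin.zero_le _) (Fin.zero_le _)).trans_eq hp
  have hmem : diagEntry (n + 1) T 0 ∈ Set.Icc 1 ((n + 1) * (n + 1 + 1) / 2) := by
    rw [← hT.2.1]
    exact ⟨_, rfl⟩
  exact le_antisymm hle hmem.1

/-- A value strictly between two terms of a sequence which avoids it is crossed at some step. -/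
theorem exists_crossing (d : ℕ → ℕ) (t i j : ℕ) (hij : i ≤ j) (hi : d i < t) (hj : t < d j)
    (hne : ∀ k, i ≤ k → k ≤ j → d k ≠ t) :
    ∃ k, i ≤ k ∧ k < j ∧ d k < t ∧ t < d (k + 1) := by
  induction j, hij using Nat.le_induction with
  | base => omega
  | succ j hij ih =>
    by_cases h : t < d j
    · obtain ⟨k, h1, h2, h3⟩ := ih h fun k h1 h2 => hne k h1 (by omega)
      exact ⟨k, h1, by omega, h3⟩
    · exact ⟨j, hij, by omega, lt_of_le_of_ne (not_lt.1 h) (hne j hij (by omega)), hj⟩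

theorem exists_isChoice_of_tableau (n : ℕ) (a : Fin n → ℕ) (T : ShiftedCell (n + 1) → ℕ)
    (hT : IsShiftedSYT (n + 1) T)
    (hd : ∀ i : Fin n,
      diagEntry (n + 1) T i.succ = diagEntry (n + 1) T i.castSucc + a i + 1) :
    ∃ f, IsChoice n a f := by
  have hsm := hT.diagEntry_strictMono
  let c : OffDiag n → ShiftedCell (n + 1) := fun p => ⟨p.1, p.2.le⟩
  have hne : ∀ (p : OffDiag n) (k : Fin (n + 1)), diagEntry (n + 1) T k ≠ T (c p) := by
    intro p k h
    have h' := hT.1 h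
    have e1 : k = p.1.1 := congrArg (fun c : ShiftedCell (n + 1) => c.1.1) h'
    have e2 : k = p.1.2 := congrArg (fun c : ShiftedCell (n + 1) => c.1.2) h'
    exact p.2.ne (e1.symm.trans e2)
  have hex : ∀ p : OffDiag n, ∃ k : Fin n, ((p.1.1 : ℕ) ≤ k ∧ (k : ℕ) < p.1.2) ∧
      diagEntry (n + 1) T k.castSucc < T (c p) ∧ T (c p) < diagEntry (n + 1) T k.succ := by
    intro p
    have hp : (p.1.1 : ℕ) < p.1.2 := p.2
    have hp2 := p.1.2.2
    have hlo : diagEntry (n + 1) T p.1.1 < T (c p) :=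
      lt_of_le_of_ne (hT.monotone _ _ le_rfl p.2.le) (hne p _)
    have hhi : T (c p) < diagEntry (n + 1) T p.1.2 :=
      lt_of_le_of_ne (hT.monotone _ _ p.2.le le_rfl) (hne p _).symm
    let d : ℕ → ℕ := fun k => if h : k < n + 1 then diagEntry (n + 1) T ⟨k, h⟩ else 0
    have hdv : ∀ (k : ℕ) (h : k < n + 1), d k = diagEntry (n + 1) T ⟨k, h⟩ := fun k h => dif_pos h
    obtain ⟨k, h1, h2, h3, h4⟩ := exists_crossing d (T (c p)) p.1.1 p.1.2 hp.le
      (by rw [hdv _ p.1.1.2]; exact hlo) (by rw [hdv _ p.1.2.2]; exact hhi)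
      (fun k _ hk => by rw [hdv k (by omega)]; exact hne p _)
    rw [hdv k (by omega)] at h3
    rw [hdv (k + 1) (by omega)] at h4
    exact ⟨⟨k, by omega⟩, ⟨h1, h2⟩, h3, h4⟩
  choose f hf1 hf2 using hex
  refine ⟨f, hf1, fun k => ?_⟩
  have huniq : ∀ p k, diagEntry (n + 1) T k.castSucc < T (c p) →
      T (c p) < diagEntry (n + 1) T k.succ → f p = k := by
    intro p k h1 h2
    have h3 := hsm.lt_iff_lt.1 (h1.trans (hf2 p).2)
    have h4 := hsm.lt_iff_lt.1 ((hf2 p).1.trans h2)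
    rw [Fin.lt_def] at h3 h4
    simp only [Fin.val_castSucc, Fin.val_succ] at h3 h4
    exact Fin.ext (by omega)
  have hcard : (Finset.Ioo (diagEntry (n + 1) T k.castSucc) (diagEntry (n + 1) T k.succ)).card
      = a k := by
    rw [Nat.card_Ioo, hd k]
    omega
  rw [← hcard]
  refine Finset.card_bij (fun p _ => T (c p)) ?_ ?_ ?_
  · intro p hp
    simp only [Finset.mem_filter, Finset.mem_univ, true_and] at hp
    subst hp
    exact Finset.mem_Ioo.2 (hf2 p)
  · intro p _ q _ h
    exact Subtype.ext (congrArg (fun c : ShiftedCell (n + 1) => c.1) (hT.1 h))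
  · intro m hm
    rw [Finset.mem_Ioo] at hm
    have hr : m ∈ Set.range T := by
      have hlast : diagEntry (n + 1) T k.succ ∈ Set.range T := ⟨_, rfl⟩
      rw [hT.2.1, Set.mem_Icc] at hlast ⊢
      omega
    obtain ⟨q, rfl⟩ := hr
    have hq : q.1.1 < q.1.2 := by
      refine lt_of_le_of_ne q.2 fun h => ?_
      have hqd : T q = diagEntry (n + 1) T q.1.1 :=
        congrArg T (Subtype.ext (Prod.ext rfl h.symm))
      rw [hqd] at hm
      have h3 := hsm.lt_iff_lt.1 hm.1
      have h4 := hsm.lt_iff_lt.1 hm.2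
      rw [Fin.lt_def] at h3 h4
      simp only [Fin.val_castSucc, Fin.val_succ] at h3 h4
      omega
    refine ⟨⟨q.1, hq⟩, ?_, rfl⟩
    simp only [Finset.mem_filter, Finset.mem_univ, true_and]
    exact huniq ⟨q.1, hq⟩ k hm.1 hm.2

theorem exists_tableau_iff_mem (n : ℕ) (a : Fin n → ℕ) :
    (∃ T : ShiftedCell (n + 1) → ℕ, IsShiftedSYT (n + 1) T ∧ diagEntry (n + 1) T 0 = 1 ∧
      ∀ i : Fin n, diagEntry (n + 1) T i.succ = diagEntry (n + 1) T i.castSucc + a i + 1) ↔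
    (fun i => (a i : ℝ)) ∈ assocPolytope n := by
  constructor
  · rintro ⟨T, hT, -, hd⟩
    obtain ⟨f, hf⟩ := exists_isChoice_of_tableau n a T hT hd
    exact mem_assocPolytope_of_isChoice n a f hf
  · intro h
    exact exists_tableau_of_isChoice n a (exists_isChoice_of_mem n a h)

theorem finite_setOf_isShiftedSYT (n : ℕ) : {T | IsShiftedSYT n T}.Finite := by
  refine (Set.Finite.pi' fun _ : ShiftedCell n =>
    Set.finite_Icc 1 (n * (n + 1) / 2)).subset ?_
  intro T hT p
  rw [← hT.2.1]
  exact ⟨p, rfl⟩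

theorem Ntab_pos_iff (n : ℕ) (a : Fin n → ℕ) :
    0 < Ntab n a ↔ (fun i => (a i : ℝ)) ∈ assocPolytope n := by
  rw [← exists_tableau_iff_mem]
  exact Set.ncard_pos ((finite_setOf_isShiftedSYT (n + 1)).subset fun T hT => hT.1)

/-- The diagonal vector with gaps `a`. -/
def diagOfGaps (n : ℕ) (a : Fin n → ℕ) (i : Fin (n + 1)) : ℕ :=
  Fin.induction (motive := fun _ => ℕ) 1 (fun k d => d + a k + 1) i

theorem eq_diagOfGaps_iff (n : ℕ) (a : Fin n → ℕ) (d : Fin (n + 1) → ℕ) :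
    d = diagOfGaps n a ↔ d 0 = 1 ∧ ∀ i : Fin n, d i.succ = d i.castSucc + a i + 1 := by
  constructor
  · rintro rfl
    exact ⟨rfl, fun i => by simp [diagOfGaps, Fin.induction_succ]⟩
  · rintro ⟨h0, hs⟩
    funext i
    induction i using Fin.induction with
    | zero => simpa [diagOfGaps] using h0
    | succ i ih => rw [hs, ih]; simp [diagOfGaps, Fin.induction_succ]

theorem diagOfGaps_injective (n : ℕ) : Function.Injective (diagOfGaps n) := by
  intro a b h
  funext i
  have ha := ((eq_diagOfGaps_iff n a _).1 rfl).2 i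
  have hb := ((eq_diagOfGaps_iff n b _).1 rfl).2 i
  rw [h] at ha
  omega

theorem setOf_diag_eq_image (n : ℕ) :
    {d : Fin (n + 1) → ℕ | ∃ T : ShiftedCell (n + 1) → ℕ,
      IsShiftedSYT (n + 1) T ∧ ∀ i, d i = diagEntry (n + 1) T i} =
    diagOfGaps n '' {a | (fun i => (a i : ℝ)) ∈ assocPolytope n} := by
  ext d
  simp only [Set.mem_ofPred_eq, Set.mem_image, ← exists_tableau_iff_mem]
  constructor
  · rintro ⟨T, hT, hd⟩
    obtain rfl : d = diagEntry (n + 1) T := funext hd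
    have hs : ∀ i : Fin n, diagEntry (n + 1) T i.succ = diagEntry (n + 1) T i.castSucc +
        (diagEntry (n + 1) T i.succ - diagEntry (n + 1) T i.castSucc - 1) + 1 := by
      intro i
      have := hT.diagEntry_strictMono (Fin.castSucc_lt_succ (i := i))
      omega
    exact ⟨_, ⟨T, hT, hT.diagEntry_zero, hs⟩,
      ((eq_diagOfGaps_iff n _ _).2 ⟨hT.diagEntry_zero, hs⟩).symm⟩
  · rintro ⟨a, ⟨T, hT, h0, hs⟩, rfl⟩
    exact ⟨T, hT, fun i => (congrFun ((eq_diagOfGaps_iff n a _).2 ⟨h0, hs⟩) i).symm⟩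

theorem setOf_lattice_eq_image (n : ℕ) :
    {b : Fin n → ℤ | (fun i => (b i : ℝ)) ∈ assocPolytope n} =
    (fun (a : Fin n → ℕ) i => (a i : ℤ)) '' {a | (fun i => (a i : ℝ)) ∈ assocPolytope n} := by
  ext b
  simp only [Set.mem_ofPred_eq, Set.mem_image]
  constructor
  · intro hb
    obtain ⟨y, hy0, -, -, hyb⟩ := exists_decomposition n hb
    have hnn : ∀ i, 0 ≤ b i := fun i => by
      have : (0 : ℝ) ≤ b i := by
        rw [hyb i]
        exact Finset.sum_nonneg fun p _ => hy0 p i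
      exact_mod_cast this
    have hb' : (fun i => ((b i).toNat : ℤ)) = b := funext fun i => Int.toNat_of_nonneg (hnn i)
    refine ⟨fun i => (b i).toNat, ?_, hb'⟩
    convert hb using 2 with i
    exact_mod_cast congrArg (fun z : ℤ => (z : ℝ)) (congrFun hb' i)
  · rintro ⟨a, ha, rfl⟩
    simpa using ha

theorem stmt16 (n : ℕ) :
    (∀ a : Fin n → ℕ, 0 < Ntab n a ↔ (fun i => (a i : ℝ)) ∈ assocPolytope n) ∧
    Set.ncard {d : Fin (n + 1) → ℕ | ∃ T : ShiftedCell (n + 1) → ℕ,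
        IsShiftedSYT (n + 1) T ∧ ∀ i, d i = diagEntry (n + 1) T i} =
      Set.ncard {b : Fin n → ℤ | (fun i => (b i : ℝ)) ∈ assocPolytope n} := by
  refine ⟨Ntab_pos_iff n, ?_⟩
  rw [setOf_diag_eq_image, setOf_lattice_eq_image,
    Set.ncard_image_of_injective _ (diagOfGaps_injective n), Set.ncard_image_of_injective]
  intro a b h
  funext i
  exact Int.ofNat_injective (congrFun h i)
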